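/- Let β > 0 and σ > 0. For every κ ≥ 0, the function γ ↦ F_κ(γ) is continuous on [0, ∞), and |F_κ(γ)| ≤ κ for all γ ≥ 0. -/

import Mathlib

open Real MeasureTheory Filter Topology

theorem IsLocalMax.deriv_deriv_nonpos {f : ℝ → ℝ} {x : ℝ} (h : IsLocalMax f x)
    (hf : ContinuousAt f x) : deriv (deriv f) x ≤ 0 := by
  by_contra! hpos
  have hmin := isLocalMin_of_deriv_deriv_pos hpos h.deriv_eq_zero hf
  have hconst : f =ᶠ[𝓝 x] fun _ => f x := by
    filter_upwards [h, hmin] with y h₁ h₂ using le_antisymm h₁ h₂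
  have hzero : deriv (deriv f) x = 0 := by
    rw [hconst.deriv.deriv_eq]
    simp
  exact hpos.ne' hzero

theorem Function.Periodic.exists_forall_le {f : ℝ → ℝ} {c : ℝ} (hp : Function.Periodic f c)
    (hc : 0 < c) (hf : Continuous f) : ∃ x, ∀ y, f y ≤ f x := by
  obtain ⟨x, -, hx⟩ := (isCompact_Icc (a := (0 : ℝ)) (b := c)).exists_isMaxOn
    ⟨0, Set.left_mem_Icc.2 hc.le⟩ hf.continuousOn
  refine ⟨x, fun y => ?_⟩
  obtain ⟨z, hz, hyz⟩ := hp.exists_mem_Ico₀ hc y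
  rw [hyz]
  exact hx (Set.Ico_subset_Icc_self hz)

/-- Comparison principle for periodic solutions of a one-dimensional viscous
Hamilton–Jacobi equation. -/
theorem sub_le_div_of_periodic_hamiltonJacobi {β a b c K : ℝ} (hβ : 0 < β) (ha : 0 ≤ a)
    (hc : 0 < c) {u w f g : ℝ → ℝ} (hu : ContDiff ℝ 2 u) (hw : ContDiff ℝ 2 w)
    (hup : Function.Periodic u c) (hwp : Function.Periodic w c)
    (hu_eq : ∀ x, β * u x - a * deriv (deriv u) x + b * (deriv u x) ^ 2 = f x)
    (hw_eq : ∀ x, β * w x - a * deriv (deriv w) x + b * (deriv w x) ^ 2 = g x)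
    (hfg : ∀ x, f x - g x ≤ K) (x : ℝ) : u x - w x ≤ K / β := by
  obtain ⟨m, hm⟩ := (hup.sub hwp).exists_forall_le hc (hu.continuous.sub hw.continuous)
  have hmax : IsLocalMax (u - w) m := Eventually.of_forall hm
  have hud : Differentiable ℝ u := hu.differentiable (by norm_num)
  have hwd : Differentiable ℝ w := hw.differentiable (by norm_num)
  have hudd : Differentiable ℝ (deriv u) :=
    (hu.iterate_deriv' 1 1).differentiable (by norm_num)
  have hwdd : Differentiable ℝ (deriv w) :=
    (hw.iterate_deriv' 1 1).differentiable (by norm_num)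
  have hderiv : deriv (u - w) = deriv u - deriv w := by
    ext y
    exact deriv_sub (hud y) (hwd y)
  have h₁ : deriv u m = deriv w m := by
    have := hmax.deriv_eq_zero
    rw [hderiv] at this
    exact sub_eq_zero.1 this
  have h₂ : deriv (deriv u) m - deriv (deriv w) m ≤ 0 := by
    have := hmax.deriv_deriv_nonpos (hu.continuous.sub hw.continuous).continuousAt
    rwa [hderiv, deriv_sub (hudd m) (hwdd m)] at this
  have hle : u x - w x ≤ u m - w m := hm x
  have hum := hu_eq m
  have hwm := hw_eq m
  rw [h₁] at hum
  rw [le_div_iff₀ hβ]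
  have h₃ := mul_le_mul_of_nonneg_left h₂ ha
  have h₄ := mul_le_mul_of_nonneg_left hle hβ.le
  linarith [hfg m]

/-- Weighted integrals of `exp (c * v γ x)` depend continuously on the parameter `γ` when `v` is
Lipschitz in `γ` uniformly in `x`. -/
theorem continuousOn_integral_mul_exp_of_abs_sub_le {v : ℝ → ℝ → ℝ} {S : Set ℝ} {L c a b : ℝ}
    (hL : 0 ≤ L) (hv : ∀ γ ∈ S, Continuous (v γ))
    (hlip : ∀ γ ∈ S, ∀ γ' ∈ S, ∀ x, |v γ x - v γ' x| ≤ L * |γ - γ'|)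
    {φ : ℝ → ℝ} (hφ : Continuous φ) :
    ContinuousOn (fun γ => ∫ x in a..b, φ x * Real.exp (c * v γ x)) S := by
  intro γ₀ hγ₀
  have hnear : ∀ᶠ γ in 𝓝[S] γ₀, |γ - γ₀| ≤ 1 := by
    refine nhdsWithin_le_nhds ?_
    filter_upwards [Metric.closedBall_mem_nhds γ₀ one_pos] with γ hγ
    simpa [Real.dist_eq] using hγ
  have hcont : ∀ γ ∈ S, Continuous fun x => φ x * Real.exp (c * v γ x) := fun γ hγ =>
    hφ.mul (Real.continuous_exp.comp (continuous_const.mul (hv γ hγ)))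
  have hv₀ := hv γ₀ hγ₀
  refine intervalIntegral.continuousWithinAt_of_dominated_interval
    (bound := fun x => |φ x| * Real.exp (|c| * (|v γ₀ x| + L))) ?_ ?_ ?_ ?_
  · filter_upwards [self_mem_nhdsWithin] with γ hγ
    exact (hcont γ hγ).aestronglyMeasurable
  · filter_upwards [self_mem_nhdsWithin, hnear] with γ hγ hγ₁
    refine Eventually.of_forall fun x _ => ?_
    rw [Real.norm_eq_abs, abs_mul, Real.abs_exp]
    refine mul_le_mul_of_nonneg_left (Real.exp_le_exp.2 ((le_abs_self _).trans ?_)) (abs_nonneg _)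
    rw [abs_mul]
    refine mul_le_mul_of_nonneg_left ?_ (abs_nonneg c)
    have h₁ := hlip γ hγ γ₀ hγ₀ x
    have h₂ := abs_sub_abs_le_abs_sub (v γ x) (v γ₀ x)
    have h₃ := mul_le_mul_of_nonneg_left hγ₁ hL
    linarith
  · exact Continuous.intervalIntegrable (by fun_prop) a b
  · refine Eventually.of_forall fun x _ => ?_
    have hx : ContinuousWithinAt (fun γ => v γ x) S γ₀ := by
      refine tendsto_iff_dist_tendsto_zero.2 ?_
      have hlim : Tendsto (fun γ => L * |γ - γ₀|) (𝓝[S] γ₀) (𝓝 0) := by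
        have : Continuous fun γ => L * |γ - γ₀| := by fun_prop
        simpa using (this.tendsto γ₀).mono_left nhdsWithin_le_nhds
      refine squeeze_zero' (Eventually.of_forall fun _ => dist_nonneg) ?_ hlim
      filter_upwards [self_mem_nhdsWithin] with γ hγ
      exact hlip γ hγ γ₀ hγ₀ x
    exact continuousWithinAt_const.mul
      (Real.continuous_exp.continuousAt.comp_continuousWithinAt (continuousWithinAt_const.mul hx))

/-- For every `κ ≥ 0`, the map `γ ↦ F_κ(γ)` is continuous on `[0, ∞)`
and satisfies `|F_κ(γ)| ≤ κ` there. -/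
theorem kuramoto_F_continuous_and_bounded
    (β σ : ℝ) (hβ : 0 < β) (hσ : 0 < σ)
    (v : ℝ → ℝ → ℝ)
    (hper : ∀ γ, 0 ≤ γ → Function.Periodic (v γ) (2 * π))
    (hC2 : ∀ γ, 0 ≤ γ → ContDiff ℝ 2 (v γ))
    (hODE : ∀ γ, 0 ≤ γ → ∀ x : ℝ,
      β * v γ x - σ ^ 2 / 2 * deriv (deriv (v γ)) x + (1 / 2) * (deriv (v γ) x) ^ 2
        = -γ * Real.cos x)
    (Z : ℝ → ℝ)
    (hZ : ∀ γ, Z γ = ∫ y in (-π)..π, Real.exp (-(2 / σ ^ 2) * v γ y))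
    (F : ℝ → ℝ → ℝ)
    (hF : ∀ κ γ, F κ γ
      = κ * (∫ x in (-π)..π, Real.cos x * Real.exp (-(2 / σ ^ 2) * v γ x)) / Z γ)
    (κ : ℝ) (hκ : 0 ≤ κ) :
    ContinuousOn (fun γ : ℝ => F κ γ) (Set.Ici 0) ∧
    ∀ γ : ℝ, 0 ≤ γ → |F κ γ| ≤ κ := by
  have hvc : ∀ γ ∈ Set.Ici (0 : ℝ), Continuous (v γ) := fun γ hγ => (hC2 γ hγ).continuous
  have hone : ∀ γ ∈ Set.Ici (0 : ℝ), ∀ γ' ∈ Set.Ici (0 : ℝ), ∀ x,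
      v γ x - v γ' x ≤ |γ - γ'| / β := fun γ hγ γ' hγ' x => by
    refine sub_le_div_of_periodic_hamiltonJacobi hβ (by positivity) Real.two_pi_pos (hC2 γ hγ)
      (hC2 γ' hγ') (hper γ hγ) (hper γ' hγ') (hODE γ hγ) (hODE γ' hγ') (fun y => ?_) x
    calc -γ * Real.cos y - -γ' * Real.cos y = -((γ - γ') * Real.cos y) := by ring
      _ ≤ |(γ - γ') * Real.cos y| := neg_le_abs _
      _ = |γ - γ'| * |Real.cos y| := abs_mul _ _
      _ ≤ |γ - γ'| := mul_le_of_le_one_right (abs_nonneg _) (Real.abs_cos_le_one y)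
  have hlip : ∀ γ ∈ Set.Ici (0 : ℝ), ∀ γ' ∈ Set.Ici (0 : ℝ), ∀ x,
      |v γ x - v γ' x| ≤ β⁻¹ * |γ - γ'| := fun γ hγ γ' hγ' x => by
    rw [inv_mul_eq_div]
    refine abs_sub_le_iff.2 ⟨hone γ hγ γ' hγ' x, ?_⟩
    rw [abs_sub_comm]
    exact hone γ' hγ' γ hγ x
  have hexp : ∀ γ ∈ Set.Ici (0 : ℝ),
      Continuous fun x => Real.exp (-(2 / σ ^ 2) * v γ x) := fun γ hγ =>
    Real.continuous_exp.comp (continuous_const.mul (hvc γ hγ))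
  have hπ : -π < π := neg_lt_self Real.pi_pos
  have hZpos : ∀ γ ∈ Set.Ici (0 : ℝ), 0 < Z γ := fun γ hγ => by
    rw [hZ]
    exact intervalIntegral.intervalIntegral_pos_of_pos ((hexp γ hγ).intervalIntegrable _ _)
      (fun _ => Real.exp_pos _) hπ
  refine ⟨?_, fun γ hγ => ?_⟩
  · have hnum := continuousOn_integral_mul_exp_of_abs_sub_le (c := -(2 / σ ^ 2)) (a := -π) (b := π)
      (inv_nonneg.2 hβ.le) hvc hlip Real.continuous_cos
    have hden : ContinuousOn Z (Set.Ici 0) := by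
      have := continuousOn_integral_mul_exp_of_abs_sub_le (c := -(2 / σ ^ 2)) (a := -π) (b := π)
        (inv_nonneg.2 hβ.le) hvc hlip (continuous_const (y := (1 : ℝ)))
      simpa only [one_mul, ← hZ] using this
    simp only [hF]
    exact (continuousOn_const.mul hnum).div hden fun γ hγ => (hZpos γ hγ).ne'
  · have hbound : |∫ x in (-π)..π, Real.cos x * Real.exp (-(2 / σ ^ 2) * v γ x)| ≤ Z γ := by
      rw [hZ, ← Real.norm_eq_abs]
      refine intervalIntegral.norm_integral_le_of_norm_le hπ.le
        (Eventually.of_forall fun x _ => ?_) ((hexp γ hγ).intervalIntegrable _ _)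
      rw [Real.norm_eq_abs, abs_mul, Real.abs_exp]
      exact mul_le_of_le_one_left (Real.exp_pos _).le (Real.abs_cos_le_one x)
    rw [hF, abs_div, abs_mul, abs_of_nonneg hκ, abs_of_pos (hZpos γ hγ),
      div_le_iff₀ (hZpos γ hγ)]
    exact mul_le_mul_of_nonneg_left hbound hκ
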